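/- (Walsh case m ≡ 2.) Let 0 < p < 1/2. There exists a constant c_p > 0, depending only on p, such that for every martingale f ∈ H_p(G) and every n ∈ ℕ, ‖σ_{2^n + 1} f‖_{L_p(μ)} ≤ c_p · 2^{(1/p − 2) n} · ‖f‖_{H_p}. -/

import Mathlib

open MeasureTheory Filter
open scoped ENNReal NNReal Real BigOperators

noncomputable section

namespace Vilenkin

instance (k : ℕ) : MeasurableSpace (ZMod k) := ⊤

/-- The Vilenkin group: the product of the cyclic groups `ZMod (m n)`. -/
abbrev G (m : ℕ → ℕ) : Type := ∀ n : ℕ, ZMod (m n)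

variable (m : ℕ → ℕ)

/-- The generalized powers `M_0 = 1`, `M_{n+1} = m_n M_n`. -/
def Mprod : ℕ → ℕ
  | 0 => 1
  | n + 1 => m n * Mprod n

/-- The `k`-th digit of `n` in the base-`M` expansion `n = Σ_k n_k M_k`. -/
def digit (n k : ℕ) : ℕ := (n / Mprod m k) % m k

/-- `⟨n⟩`, the smallest index of a nonzero digit. -/
def lowIdx (n : ℕ) : ℕ := sInf {j | digit m n j ≠ 0}

/-- `|n|`, the largest index of a nonzero digit. -/
def highIdx (n : ℕ) : ℕ := sSup {j | digit m n j ≠ 0}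

/-- Generalized Rademacher functions `r_k(x) = exp(2πi x_k / m_k)`. -/
def rad (k : ℕ) (x : G m) : ℂ :=
  Complex.exp (2 * Real.pi * Complex.I * ((x k).val : ℂ) / (m k : ℂ))

/-- The Vilenkin system `ψ_n = ∏_k r_k^{n_k}`. -/
def psi (n : ℕ) (x : G m) : ℂ :=
  ∏ k ∈ Finset.range (n + 1), rad m k x ^ digit m n k

/-- Dirichlet kernels `D_n = Σ_{k<n} ψ_k`. -/
def Dker (n : ℕ) (x : G m) : ℂ := ∑ k ∈ Finset.range n, psi m k x

/-- Fejér kernels `K_n = (1/n) Σ_{k<n} D_k`. -/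
def Kker (n : ℕ) (x : G m) : ℂ := (n : ℂ)⁻¹ * ∑ k ∈ Finset.range n, Dker m k x

/-- The cylinder `I_n(x)`. -/
def cylinder (n : ℕ) (x : G m) : Set (G m) := {y | ∀ j, j < n → y j = x j}

/-- `e_t`: the element with `t`-th coordinate `1` and all others `0`. -/
def eVec (t : ℕ) : G m := fun j => if j = t then 1 else 0

/-- The filtration `F_n` generated by the cylinders of level `n`. -/
def filtr (n : ℕ) : MeasurableSpace (G m) :=
  MeasurableSpace.comap (fun x (j : Fin n) => x j.val) inferInstance

/-- The normalized Haar measure on `G_m`: the probability measure giving each cylinder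
`I_n(x)` measure `1/M_n`. -/
def IsVilenkinMeasure (μ : Measure (G m)) : Prop :=
  IsProbabilityMeasure μ ∧ ∀ n x, μ (cylinder m n x) = (Mprod m n : ℝ≥0∞)⁻¹

/-- Martingales with respect to the filtration `(F_n)`. -/
def IsMartingale (μ : Measure (G m)) (f : ℕ → G m → ℂ) : Prop :=
  (∀ n, Integrable (f n) μ) ∧
  (∀ n, Measurable[filtr m n] (f n)) ∧
  (∀ n, ∀ s : Set (G m), MeasurableSet[filtr m n] s →
    ∫ x in s, f (n + 1) x ∂μ = ∫ x in s, f n x ∂μ)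

/-- The maximal function `f* = sup_n |f^{(n)}|` (with values in `ℝ≥0∞`). -/
def maximalFn (f : ℕ → G m → ℂ) (x : G m) : ℝ≥0∞ := ⨆ n, (‖f n x‖₊ : ℝ≥0∞)

/-- The martingale Hardy space quasi-norm `‖f‖_{H_p} = ‖f*‖_{L_p}`. -/
def hardyNorm (p : ℝ) (μ : Measure (G m)) (f : ℕ → G m → ℂ) : ℝ≥0∞ :=
  (∫⁻ x, maximalFn m f x ^ p ∂μ) ^ (1 / p)

/-- Vilenkin-Fourier coefficients of an integrable function. -/
def fourierCoeff (μ : Measure (G m)) (g : G m → ℂ) (k : ℕ) : ℂ :=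
  ∫ x, g x * (starRingEnd ℂ) (psi m k x) ∂μ

/-- Partial sums `S_n g` of the Vilenkin-Fourier series of a function. -/
def SFun (μ : Measure (G m)) (g : G m → ℂ) (n : ℕ) (x : G m) : ℂ :=
  ∑ k ∈ Finset.range n, fourierCoeff m μ g k * psi m k x

/-- Fejér means `σ_n g` of a function. -/
def sigmaFun (μ : Measure (G m)) (g : G m → ℂ) (n : ℕ) (x : G m) : ℂ :=
  (n : ℂ)⁻¹ * ∑ k ∈ Finset.range n, SFun m μ g k x

/-- Vilenkin-Fourier coefficients of a martingale:
`f̂(i) = lim_k ∫ f^{(k)} ψ̄_i dμ`. -/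
def martCoeff (μ : Measure (G m)) (f : ℕ → G m → ℂ) (i : ℕ) : ℂ :=
  limUnder atTop fun k => ∫ x, f k x * (starRingEnd ℂ) (psi m i x) ∂μ

/-- Partial sums `S_n f` of the Vilenkin-Fourier series of a martingale. -/
def SMart (μ : Measure (G m)) (f : ℕ → G m → ℂ) (n : ℕ) (x : G m) : ℂ :=
  ∑ k ∈ Finset.range n, martCoeff m μ f k * psi m k x

/-- Fejér means `σ_n f` of a martingale. -/
def sigmaMart (μ : Measure (G m)) (f : ℕ → G m → ℂ) (n : ℕ) (x : G m) : ℂ :=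
  (n : ℂ)⁻¹ * ∑ k ∈ Finset.range n, SMart m μ f k x

/-- The weak `L_p` quasi-norm `‖g‖_{L_{p,∞}} = (sup_λ λ^p μ(|g|>λ))^{1/p}`. -/
def weakNorm (p : ℝ) (μ : Measure (G m)) (g : G m → ℂ) : ℝ≥0∞ :=
  (⨆ lam : ℝ≥0, (lam : ℝ≥0∞) ^ p * μ {x | (lam : ℝ) < ‖g x‖}) ^ (1 / p)

/-- A `p`-atom with prescribed support interval `I_N(x₀)`. -/
def IsPAtomAt (p : ℝ) (μ : Measure (G m)) (N : ℕ) (x₀ : G m) (a : G m → ℂ) : Prop :=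
  Measurable a ∧ Function.support a ⊆ cylinder m N x₀ ∧
    (∫ x in cylinder m N x₀, a x ∂μ) = 0 ∧
    eLpNorm a ⊤ μ ≤ μ (cylinder m N x₀) ^ (-(1 / p))

/-- A `p`-atom. -/
def IsPAtom (p : ℝ) (μ : Measure (G m)) (a : G m → ℂ) : Prop :=
  ∃ N x₀, IsPAtomAt m p μ N x₀ a

/-- The sets `I_N^{i,j}` for `i < j ≤ N`. -/
def IsetIJ (N i j : ℕ) : Set (G m) :=
  if j < N then
    {x | (∀ l, l < i → x l = 0) ∧ x i ≠ 0 ∧ (∀ l, i < l → l < j → x l = 0) ∧ x j ≠ 0}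
  else
    {x | (∀ l, l < i → x l = 0) ∧ x i ≠ 0 ∧ (∀ l, i < l → l < N → x l = 0)}

/-- The constant sequence `2`, for which the Vilenkin system is the Walsh–Paley system. -/
abbrev dyadic : ℕ → ℕ := fun _ => 2

section Walsh

lemma Mprod_dyadic (n : ℕ) : Mprod dyadic n = 2 ^ n := by
  induction n with
  | zero => rfl
  | succ n ih => rw [Mprod, ih, pow_succ, mul_comm]

lemma digit_dyadic (i k : ℕ) : digit dyadic i k = (i.testBit k).toNat := by
  rw [digit, Mprod_dyadic, Nat.toNat_testBit]

lemma digit_eq_zero_of_lt {i k : ℕ} (h : i < 2 ^ k) : digit dyadic i k = 0 := by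
  rw [digit_dyadic, Nat.testBit_lt_two_pow h, Bool.toNat_false]

lemma digit_two_pow_add_self {n i : ℕ} (h : i < 2 ^ n) : digit dyadic (2 ^ n + i) n = 1 := by
  rw [digit_dyadic, Nat.testBit_two_pow_add_eq, Nat.testBit_lt_two_pow h]
  rfl

lemma digit_two_pow_add_of_lt {n k : ℕ} (i : ℕ) (h : k < n) :
    digit dyadic (2 ^ n + i) k = digit dyadic i k := by
  rw [digit_dyadic, digit_dyadic, Nat.testBit_two_pow_add_gt h]

lemma sum_two_pow_mul_digit (n : ℕ) :
    ∀ i < 2 ^ n, ∑ j ∈ Finset.range n, 2 ^ j * digit dyadic i j = i := by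
  induction n with
  | zero => intro i hi; simp at hi ⊢; omega
  | succ n ih =>
    intro i hi
    rw [Finset.sum_range_succ]
    rcases lt_or_ge i (2 ^ n) with h | h
    · rw [ih i h, digit_eq_zero_of_lt h, mul_zero, add_zero]
    · obtain ⟨l, rfl⟩ := Nat.exists_eq_add_of_le h
      have hl : l < 2 ^ n := by rw [pow_succ] at hi; omega
      rw [digit_two_pow_add_self hl, Finset.sum_congr rfl fun j hj => by
        rw [digit_two_pow_add_of_lt l (Finset.mem_range.1 hj)], ih l hl]
      omega

lemma rad_dyadic (k : ℕ) (x : G dyadic) : rad dyadic k x = (-1) ^ (x k).val := by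
  rw [rad, ← Complex.exp_pi_mul_I, ← Complex.exp_nat_mul]
  congr 1
  push_cast
  ring

lemma rad_eq_one_or (k : ℕ) (x : G dyadic) : rad dyadic k x = 1 ∨ rad dyadic k x = -1 := by
  rw [rad_dyadic]
  exact neg_one_pow_eq_or ℂ _

lemma psi_eq_prod_range {n i : ℕ} (h : i < 2 ^ n) (x : G dyadic) :
    psi dyadic i x = ∏ k ∈ Finset.range n, rad dyadic k x ^ digit dyadic i k := by
  have key : ∀ a b : ℕ, a ≤ b → i < 2 ^ a →
      ∏ k ∈ Finset.range a, rad dyadic k x ^ digit dyadic i k =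
        ∏ k ∈ Finset.range b, rad dyadic k x ^ digit dyadic i k := by
    intro a b hab ha
    refine Finset.prod_subset (by simpa using hab) fun k _ hk => ?_
    rw [Finset.mem_range, not_lt] at hk
    rw [digit_eq_zero_of_lt (ha.trans_le (Nat.pow_le_pow_right two_pos hk)), pow_zero]
  have hi : i < 2 ^ (i + 1) :=
    Nat.lt_two_pow_self.trans_le (Nat.pow_le_pow_right two_pos i.le_succ)
  rw [psi, key _ _ (le_max_left (i + 1) n) hi, key _ _ (le_max_right (i + 1) n) h]

lemma psi_two_pow_add {n i : ℕ} (h : i < 2 ^ n) (x : G dyadic) :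
    psi dyadic (2 ^ n + i) x = rad dyadic n x * psi dyadic i x := by
  have h' : 2 ^ n + i < 2 ^ (n + 1) := by rw [pow_succ]; omega
  rw [psi_eq_prod_range h', psi_eq_prod_range h, Finset.prod_range_succ,
    digit_two_pow_add_self h, pow_one, mul_comm]
  congr 1
  exact Finset.prod_congr rfl fun k hk => by
    rw [digit_two_pow_add_of_lt i (Finset.mem_range.1 hk)]

lemma psi_eq_one_or (i : ℕ) (x : G dyadic) : psi dyadic i x = 1 ∨ psi dyadic i x = -1 := by
  rw [psi]
  refine Finset.prod_induction _ (fun z : ℂ => z = 1 ∨ z = -1) ?_ (Or.inl rfl) fun k _ => ?_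
  · rintro a b (rfl | rfl) (rfl | rfl) <;> simp
  · rcases rad_eq_one_or k x with h | h <;> rw [h]
    · simp
    · exact neg_one_pow_eq_or ℂ _

lemma conj_psi (i : ℕ) (x : G dyadic) :
    (starRingEnd ℂ) (psi dyadic i x) = psi dyadic i x := by
  rcases psi_eq_one_or i x with h | h <;> simp [h]

lemma zmod_two_eq_zero_or_one : ∀ a : ZMod 2, a = 0 ∨ a = 1 := by decide

lemma rad_add_eVec (k j : ℕ) (x : G dyadic) :
    rad dyadic k (x + eVec dyadic j) = rad dyadic k x * if k = j then -1 else 1 := by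
  have hval : (1 + 1 : ZMod 2).val = 0 := rfl
  have key : ∀ a : ZMod 2, (-1 : ℂ) ^ (a + 1).val = (-1) ^ a.val * -1 := by
    intro a
    rcases zmod_two_eq_zero_or_one a with rfl | rfl <;> simp [ZMod.val_one, hval]
  rw [rad_dyadic, rad_dyadic, Pi.add_apply, eVec]
  split_ifs with h
  · exact key _
  · rw [add_zero, mul_one]

lemma psi_add_eVec {n i j : ℕ} (hi : i < 2 ^ n) (hj : j < n) (x : G dyadic) :
    psi dyadic i (x + eVec dyadic j) = (1 - 2 * (digit dyadic i j : ℂ)) * psi dyadic i x := by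
  rw [psi_eq_prod_range hi, psi_eq_prod_range hi]
  simp only [rad_add_eVec, mul_pow, Finset.prod_mul_distrib, ite_pow, one_pow]
  rw [Finset.prod_ite_eq' (Finset.range n), if_pos (Finset.mem_range.2 hj), mul_comm]
  congr 1
  rw [digit_dyadic]
  cases i.testBit j <;> norm_num

/-- The Dirichlet kernel of order `2 ^ n` is `2 ^ n` times the indicator of a cylinder. -/
lemma sum_psi_mul_psi (n : ℕ) (x y : G dyadic) :
    ∑ i ∈ Finset.range (2 ^ n), psi dyadic i x * psi dyadic i y =
      (cylinder dyadic n x).indicator (fun _ => (2 : ℂ) ^ n) y := by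
  classical
  induction n with
  | zero => simp [psi, digit, cylinder]
  | succ n ih =>
    have hsplit : ∑ i ∈ Finset.range (2 ^ (n + 1)), psi dyadic i x * psi dyadic i y =
        (1 + rad dyadic n x * rad dyadic n y) *
          ∑ i ∈ Finset.range (2 ^ n), psi dyadic i x * psi dyadic i y := by
      rw [pow_succ, mul_two, Finset.sum_range_add, add_mul, one_mul, Finset.mul_sum]
      congr 1
      refine Finset.sum_congr rfl fun i hi => ?_
      rw [Finset.mem_range] at hi
      rw [psi_two_pow_add hi, psi_two_pow_add hi]
      ring
    have hmem : y ∈ cylinder dyadic (n + 1) x ↔ y ∈ cylinder dyadic n x ∧ y n = x n := by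
      simp only [cylinder, Set.mem_ofPred_eq]
      refine ⟨fun h => ⟨fun j hj => h j (by omega), h n (by omega)⟩, fun h j hj => ?_⟩
      rcases Nat.lt_succ_iff_lt_or_eq.1 hj with h' | rfl
      exacts [h.1 j h', h.2]
    have hrad : 1 + rad dyadic n x * rad dyadic n y = if y n = x n then 2 else 0 := by
      have key : ∀ a b : ZMod 2,
          1 + (-1 : ℂ) ^ a.val * (-1) ^ b.val = if b = a then 2 else 0 := by
        intro a b
        rcases zmod_two_eq_zero_or_one a with rfl | rfl <;>
          rcases zmod_two_eq_zero_or_one b with rfl | rfl <;> norm_num [ZMod.val_one]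
      rw [rad_dyadic, rad_dyadic]
      exact key _ _
    rw [hsplit, ih, hrad]
    simp only [Set.indicator_apply, hmem]
    by_cases h1 : y ∈ cylinder dyadic n x <;> by_cases h2 : y n = x n <;>
      simp [h1, h2, pow_succ, mul_comm]

/-- The Fejér sum of order `2 ^ n` of a Walsh polynomial is a combination of translates of its
partial sum of order `2 ^ n`. -/
lemma sum_partialSums_two_pow (c : ℕ → ℂ) (n : ℕ) (x : G dyadic) :
    ∑ k ∈ Finset.range (2 ^ n), ∑ i ∈ Finset.range k, c i * psi dyadic i x =
      ((2 : ℂ) ^ n - 1) / 2 * ∑ i ∈ Finset.range (2 ^ n), c i * psi dyadic i x +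
        ∑ j ∈ Finset.range n, (2 : ℂ) ^ j / 2 *
          ∑ i ∈ Finset.range (2 ^ n), c i * psi dyadic i (x + eVec dyadic j) := by
  have hgeom : ∑ j ∈ Finset.range n, (2 : ℂ) ^ j = 2 ^ n - 1 := by
    rw [geom_sum_eq (by norm_num)]
    norm_num
  have hcount : ∀ N : ℕ, ∑ k ∈ Finset.range N, ∑ i ∈ Finset.range k, c i * psi dyadic i x =
      ∑ i ∈ Finset.range N, ((N : ℂ) - 1 - i) * (c i * psi dyadic i x) := by
    intro N
    induction N with
    | zero => simp
    | succ N ih =>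
      rw [Finset.sum_range_succ, ih, Finset.sum_range_succ _ N, ← Finset.sum_add_distrib]
      push_cast
      rw [show ((N : ℂ) + 1 - 1 - N) = 0 by ring, zero_mul, add_zero]
      exact Finset.sum_congr rfl fun i _ => by ring
  rw [hcount]
  simp only [Finset.mul_sum]
  rw [Finset.sum_comm, ← Finset.sum_add_distrib]
  refine Finset.sum_congr rfl fun i hi => ?_
  rw [Finset.mem_range] at hi
  have hdig : ∑ j ∈ Finset.range n, (2 : ℂ) ^ j * digit dyadic i j = i := by
    exact_mod_cast congrArg (Nat.cast : ℕ → ℂ) (sum_two_pow_mul_digit n i hi)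
  have hsum : ∑ j ∈ Finset.range n,
      (2 : ℂ) ^ j / 2 * (c i * psi dyadic i (x + eVec dyadic j)) =
      (((2 : ℂ) ^ n - 1) / 2 - i) * (c i * psi dyadic i x) := by
    rw [← hgeom, ← hdig, Finset.sum_div, ← Finset.sum_sub_distrib, Finset.sum_mul]
    refine Finset.sum_congr rfl fun j hj => ?_
    rw [psi_add_eVec hi (Finset.mem_range.1 hj)]
    ring
  rw [hsum]
  push_cast
  ring

end Walsh

section Measure

/-- Truncation of a point of the Vilenkin group to its first `n` coordinates. -/
def trunc (n : ℕ) (x : G m) (j : Fin n) : ZMod (m j) := x j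

lemma measurable_trunc (n : ℕ) : Measurable (trunc m n) :=
  measurable_pi_lambda _ fun j => measurable_pi_apply j.val

lemma filtr_eq_comap_trunc (n : ℕ) :
    filtr m n = MeasurableSpace.comap (trunc m n) inferInstance := rfl

lemma filtr_le (n : ℕ) : filtr m n ≤ MeasurableSpace.pi :=
  (measurable_trunc m n).comap_le

lemma cylinder_eq_preimage (n : ℕ) (x : G m) :
    cylinder m n x = trunc m n ⁻¹' {trunc m n x} := by
  ext y
  simp only [cylinder, Set.mem_ofPred_eq, Set.mem_preimage, Set.mem_singleton_iff, funext_iff]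
  exact ⟨fun h j => h j j.2, fun h j hj => h ⟨j, hj⟩⟩

lemma measurableSet_cylinder [∀ k, Countable (ZMod (m k))] (n : ℕ) (x : G m) :
    MeasurableSet (cylinder m n x) := by
  rw [cylinder_eq_preimage]
  exact measurable_trunc m n (measurableSet_singleton _)

variable {m} in
lemma eq_of_mem_cylinder {β : Type*} [MeasurableSpace β] [MeasurableSingletonClass β] {n : ℕ}
    {g : G m → β} (hg : Measurable[filtr m n] g) {x y : G m} (h : y ∈ cylinder m n x) :
    g y = g x := by
  rw [cylinder_eq_preimage] at h
  exact hg.factorsThrough h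

instance (k : ℕ) : Countable (ZMod (dyadic k)) := inferInstanceAs (Countable (Fin 2))

lemma measurable_psi {i n : ℕ} (h : i < 2 ^ n) :
    Measurable[filtr dyadic n] (psi dyadic i) := by
  let g : (∀ j : Fin n, ZMod (dyadic j)) → ℂ :=
    fun v => ∏ k : Fin n, ((-1 : ℂ) ^ (v k).val) ^ digit dyadic i k
  have hg : psi dyadic i = g ∘ trunc dyadic n := by
    funext x
    rw [psi_eq_prod_range h, Finset.prod_range]
    simp only [rad_dyadic]
    rfl
  rw [hg, filtr_eq_comap_trunc]
  exact (Measurable.of_discrete (f := g)).comp (comap_measurable _)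

variable {μ : Measure (G dyadic)}

lemma measure_cylinder (hμ : IsVilenkinMeasure dyadic μ) (n : ℕ) (x : G dyadic) :
    μ (cylinder dyadic n x) = ((2 : ℝ≥0∞) ^ n)⁻¹ := by
  rw [hμ.2, Mprod_dyadic]
  norm_cast

/-- The Vilenkin measure is invariant under translations, tested on `F_n`-measurable functions. -/
lemma lintegral_add_right (hμ : IsVilenkinMeasure dyadic μ) {n : ℕ} {g : G dyadic → ℝ≥0∞}
    (hg : Measurable[filtr dyadic n] g) (t : G dyadic) :
    ∫⁻ x, g (x + t) ∂μ = ∫⁻ x, g x ∂μ := by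
  rw [filtr_eq_comap_trunc] at hg
  obtain ⟨g', hg', rfl⟩ := hg.exists_eq_measurable_comp
  have hT := measurable_trunc dyadic n
  have hS : Measurable fun v : (∀ j : Fin n, ZMod (dyadic j)) => v + trunc dyadic n t :=
    Measurable.of_discrete
  have hmap : (μ.map (trunc dyadic n)).map (fun v => v + trunc dyadic n t) =
      μ.map (trunc dyadic n) := by
    have hone : ∀ v, (μ.map (trunc dyadic n)) {v} = ((2 : ℝ≥0∞) ^ n)⁻¹ := by
      intro v
      obtain ⟨x, rfl⟩ : ∃ x, trunc dyadic n x = v :=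
        ⟨fun j => if h : j < n then v ⟨j, h⟩ else 0, by funext j; simp [trunc]⟩
      rw [Measure.map_apply hT (measurableSet_singleton _), ← cylinder_eq_preimage,
        measure_cylinder hμ]
    refine Measure.ext_of_singleton fun v => ?_
    rw [Measure.map_apply hS (measurableSet_singleton _), hone]
    convert hone (v - trunc dyadic n t) using 2
    ext w
    exact (eq_sub_iff_add_eq (a := w)).symm
  calc ∫⁻ x, (g' ∘ trunc dyadic n) (x + t) ∂μ
      = ∫⁻ x, g' (trunc dyadic n x + trunc dyadic n t) ∂μ := rfl
    _ = ∫⁻ v, g' v ∂((μ.map (trunc dyadic n)).map (fun v => v + trunc dyadic n t)) := by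
        rw [lintegral_map hg' hS]
        exact (lintegral_map (hg'.comp hS) hT).symm
    _ = ∫⁻ x, (g' ∘ trunc dyadic n) x ∂μ := by
        rw [hmap, lintegral_map hg' hT]
        rfl

end Measure

section Martingale

variable {μ : Measure (G dyadic)} {f : ℕ → G dyadic → ℂ}

lemma integrable_mul_psi {g : G dyadic → ℂ} (hg : Integrable g μ) (i : ℕ) :
    Integrable (fun x => g x * psi dyadic i x) μ := by
  have hmeas : Measurable (psi dyadic i) :=
    (measurable_psi Nat.lt_two_pow_self).mono (filtr_le dyadic i) le_rfl
  refine hg.mul_bdd (c := 1) hmeas.aestronglyMeasurable (Eventually.of_forall fun x => ?_)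
  rcases psi_eq_one_or i x with h | h <;> simp [h]

lemma integral_succ_mul_psi (hf : IsMartingale dyadic μ f) {i n : ℕ} (h : i < 2 ^ n) :
    ∫ x, f (n + 1) x * psi dyadic i x ∂μ = ∫ x, f n x * psi dyadic i x ∂μ := by
  set A : Set (G dyadic) := psi dyadic i ⁻¹' {1} with hA
  have hAn : MeasurableSet[filtr dyadic n] A := measurable_psi h (measurableSet_singleton _)
  have hAm : MeasurableSet A := filtr_le dyadic n _ hAn
  have key : ∀ k, ∫ x, f k x * psi dyadic i x ∂μ = ∫ x in A, f k x ∂μ - ∫ x in Aᶜ, f k x ∂μ := by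
    intro k
    rw [← integral_add_compl hAm (integrable_mul_psi (hf.1 k) i), sub_eq_add_neg, ← integral_neg]
    congr 1
    · refine setIntegral_congr_fun hAm fun x hx => ?_
      have hx : psi dyadic i x = 1 := hx
      simp [hx]
    · refine setIntegral_congr_fun hAm.compl fun x hx => ?_
      have hx : psi dyadic i x = -1 := (psi_eq_one_or i x).resolve_left hx
      simp [hx]
  rw [key, key, hf.2.2 n A hAn, hf.2.2 n Aᶜ hAn.compl]

lemma martCoeff_eq_integral (hf : IsMartingale dyadic μ f) {i n : ℕ} (h : i < 2 ^ n) :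
    martCoeff dyadic μ f i = ∫ x, f n x * psi dyadic i x ∂μ := by
  simp only [martCoeff, conj_psi]
  refine Tendsto.limUnder_eq (tendsto_const_nhds.congr' ?_)
  filter_upwards [eventually_ge_atTop n] with k hk
  induction k, hk using Nat.le_induction with
  | base => rfl
  | succ k hk ih =>
    rw [integral_succ_mul_psi hf (h.trans_le (Nat.pow_le_pow_right two_pos hk)), ih]

/-- The partial sum of order `2 ^ n` of a martingale is its `n`-th term. -/
lemma SMart_two_pow (hμ : IsVilenkinMeasure dyadic μ) (hf : IsMartingale dyadic μ f) (n : ℕ)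
    (x : G dyadic) : SMart dyadic μ f (2 ^ n) x = f n x := by
  have hcyl := measurableSet_cylinder dyadic n x
  have hint : ∀ i ∈ Finset.range (2 ^ n),
      Integrable (fun y => f n y * psi dyadic i y * psi dyadic i x) μ :=
    fun i _ => (integrable_mul_psi (hf.1 n) i).mul_const _
  calc SMart dyadic μ f (2 ^ n) x
      = ∑ i ∈ Finset.range (2 ^ n), ∫ y, f n y * psi dyadic i y * psi dyadic i x ∂μ := by
        refine Finset.sum_congr rfl fun i hi => ?_
        rw [martCoeff_eq_integral hf (Finset.mem_range.1 hi), integral_mul_const]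
    _ = ∫ y, (cylinder dyadic n x).indicator (fun _ => f n x * 2 ^ n) y ∂μ := by
        rw [← integral_finsetSum _ hint]
        refine integral_congr_ae (Eventually.of_forall fun y => ?_)
        have := sum_psi_mul_psi n x y
        calc ∑ i ∈ Finset.range (2 ^ n), f n y * psi dyadic i y * psi dyadic i x
            = f n y * ∑ i ∈ Finset.range (2 ^ n), psi dyadic i x * psi dyadic i y := by
              rw [Finset.mul_sum]
              exact Finset.sum_congr rfl fun i _ => by ring
          _ = _ := by
              rw [this]
              by_cases hy : y ∈ cylinder dyadic n x
              · rw [Set.indicator_of_mem hy, Set.indicator_of_mem hy,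
                  eq_of_mem_cylinder (hf.2.1 n) hy]
              · rw [Set.indicator_of_notMem hy, Set.indicator_of_notMem hy, mul_zero]
    _ = f n x := by
        rw [integral_indicator_const _ hcyl, Measure.real, measure_cylinder hμ]
        simp
        field_simp

lemma sigmaMart_two_pow_add_one (hμ : IsVilenkinMeasure dyadic μ) (hf : IsMartingale dyadic μ f)
    (n : ℕ) (x : G dyadic) :
    sigmaMart dyadic μ f (2 ^ n + 1) x = f n x / 2 +
      ∑ j ∈ Finset.range n, (2 : ℂ) ^ j / 2 / (2 ^ n + 1) * f n (x + eVec dyadic j) := by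
  have h0 : (2 : ℂ) ^ n + 1 ≠ 0 := by exact_mod_cast Nat.succ_ne_zero (2 ^ n)
  have hS := SMart_two_pow hμ hf n
  have hF : ∑ k ∈ Finset.range (2 ^ n), SMart dyadic μ f k x =
      ((2 : ℂ) ^ n - 1) / 2 * SMart dyadic μ f (2 ^ n) x +
        ∑ j ∈ Finset.range n, (2 : ℂ) ^ j / 2 *
          SMart dyadic μ f (2 ^ n) (x + eVec dyadic j) :=
    sum_partialSums_two_pow (martCoeff dyadic μ f) n x
  simp only [hS] at hF
  rw [sigmaMart, Finset.sum_range_succ, hS, hF]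
  push_cast
  rw [Finset.sum_congr rfl fun j _ => show (2 : ℂ) ^ j / 2 / (2 ^ n + 1) * f n (x + eVec dyadic j) =
    ((2 : ℂ) ^ n + 1)⁻¹ * ((2 : ℂ) ^ j / 2 * f n (x + eVec dyadic j)) by ring, ← Finset.mul_sum]
  field_simp
  ring

lemma enorm_sigmaMart_le (hμ : IsVilenkinMeasure dyadic μ) (hf : IsMartingale dyadic μ f)
    (n : ℕ) (x : G dyadic) :
    ‖sigmaMart dyadic μ f (2 ^ n + 1) x‖ₑ ≤ ‖f n x‖ₑ +
      ∑ j ∈ Finset.range n, (2⁻¹ : ℝ≥0∞) ^ (n - j) * ‖f n (x + eVec dyadic j)‖ₑ := by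
  rw [sigmaMart_two_pow_add_one hμ hf]
  refine (enorm_add_le _ _).trans (add_le_add ?_ ((enorm_sum_le _ _).trans
    (Finset.sum_le_sum fun j hj => ?_)))
  · rw [← ofReal_norm, ← ofReal_norm, norm_div]
    refine ENNReal.ofReal_le_ofReal ?_
    norm_num
  · rw [enorm_mul]
    gcongr
    rw [Finset.mem_range] at hj
    have h1 : (2⁻¹ : ℝ≥0∞) ^ (n - j) = ENNReal.ofReal ((2⁻¹ : ℝ) ^ (n - j)) := by
      rw [ENNReal.ofReal_pow (by norm_num), ENNReal.ofReal_inv_of_pos two_pos]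
      simp
    rw [h1, ← ofReal_norm]
    refine ENNReal.ofReal_le_ofReal ?_
    have h2 : ‖(2 : ℂ) ^ n + 1‖ = 2 ^ n + 1 := by
      have : (2 : ℂ) ^ n + 1 = ((2 ^ n + 1 : ℝ) : ℂ) := by push_cast; rfl
      rw [this, Complex.norm_of_nonneg (by positivity)]
    rw [norm_div, h2, norm_div, norm_pow, Complex.norm_ofNat, inv_pow]
    obtain ⟨d, rfl⟩ := Nat.exists_eq_add_of_lt hj
    rw [show j + d + 1 - j = d + 1 by omega, div_div, div_le_iff₀ (by positivity),
      inv_mul_eq_div, le_div_iff₀ (by positivity), add_assoc j d 1, pow_add _ j]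
    nlinarith [show (0 : ℝ) < 2 ^ j * 2 ^ (d + 1) by positivity]

end Martingale

lemma rpow_sum_le_sum_rpow {ι : Type*} (s : Finset ι) (g : ι → ℝ≥0∞) {p : ℝ} (hp0 : 0 < p)
    (hp1 : p ≤ 1) : (∑ i ∈ s, g i) ^ p ≤ ∑ i ∈ s, g i ^ p :=
  Finset.le_sum_of_subadditive (fun a : ℝ≥0∞ => a ^ p) (ENNReal.zero_rpow_of_pos hp0).le
    (fun a b => ENNReal.rpow_add_le_add_rpow a b hp0.le hp1) s g

/-- The Fejér means of order `2 ^ n + 1` are bounded on `L_p`-spaces of `F_n`-measurable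
functions, uniformly in `n`. -/
lemma lintegral_sigmaMart_rpow_le {μ : Measure (G dyadic)} (hμ : IsVilenkinMeasure dyadic μ)
    {f : ℕ → G dyadic → ℂ} (hf : IsMartingale dyadic μ f) {p : ℝ} (hp0 : 0 < p) (hp1 : p ≤ 1)
    (n : ℕ) :
    ∫⁻ x, ‖sigmaMart dyadic μ f (2 ^ n + 1) x‖ₑ ^ p ∂μ ≤
      (1 + (1 - (2⁻¹ : ℝ≥0∞) ^ p)⁻¹) * ∫⁻ x, ‖f n x‖ₑ ^ p ∂μ := by
  set q : ℝ≥0∞ := (2⁻¹ : ℝ≥0∞) ^ p with hq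
  have hmeas : Measurable[filtr dyadic n] fun x => ‖f n x‖ₑ ^ p :=
    (measurable_enorm.comp (hf.2.1 n)).pow_const p
  have hmeas' : Measurable fun x => ‖f n x‖ₑ ^ p := hmeas.mono (filtr_le dyadic n) le_rfl
  have htr : ∀ t : G dyadic, Measurable fun x : G dyadic => x + t := fun t =>
    measurable_pi_lambda _ fun k =>
      (Measurable.of_discrete (f := fun a : ZMod (dyadic k) => a + t k)).comp
        (measurable_pi_apply k)
  have hshift : ∀ j, Measurable fun x => ‖f n (x + eVec dyadic j)‖ₑ ^ p := fun j =>
    hmeas'.comp (htr _)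
  have hterm : ∀ j, Measurable fun x => q ^ (n - j) * ‖f n (x + eVec dyadic j)‖ₑ ^ p :=
    fun j => (hshift j).const_mul _
  calc ∫⁻ x, ‖sigmaMart dyadic μ f (2 ^ n + 1) x‖ₑ ^ p ∂μ
      ≤ ∫⁻ x, (‖f n x‖ₑ ^ p +
          ∑ j ∈ Finset.range n, q ^ (n - j) * ‖f n (x + eVec dyadic j)‖ₑ ^ p) ∂μ := by
        refine lintegral_mono fun x => ?_
        refine (ENNReal.rpow_le_rpow (enorm_sigmaMart_le hμ hf n x) hp0.le).trans ?_
        refine (ENNReal.rpow_add_le_add_rpow _ _ hp0.le hp1).trans ?_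
        gcongr
        refine (rpow_sum_le_sum_rpow _ _ hp0 hp1).trans_eq (Finset.sum_congr rfl fun j _ => ?_)
        rw [ENNReal.mul_rpow_of_nonneg _ _ hp0.le, hq, ← ENNReal.rpow_natCast,
          ← ENNReal.rpow_natCast, ← ENNReal.rpow_mul, ← ENNReal.rpow_mul, mul_comm p]
    _ = (1 + ∑ j ∈ Finset.range n, q ^ (n - j)) * ∫⁻ x, ‖f n x‖ₑ ^ p ∂μ := by
        rw [lintegral_add_left hmeas', lintegral_finsetSum _ fun j _ => hterm j, add_mul,
          one_mul, Finset.sum_mul]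
        congr 1
        refine Finset.sum_congr rfl fun j _ => ?_
        rw [lintegral_const_mul _ (hshift j)]
        congr 1
        exact lintegral_add_right hμ hmeas _
    _ ≤ _ := by
        gcongr
        rw [← ENNReal.tsum_geometric, ← Finset.sum_range_reflect]
        refine le_trans ?_ ((ENNReal.sum_le_tsum (Finset.range (n + 1))))
        rw [Finset.sum_range_succ']
        refine le_add_right (Finset.sum_le_sum fun j hj => ?_)
        rw [Finset.mem_range] at hj
        rw [show n - (n - 1 - j) = j + 1 by omega]

/-- Corollary 4(a), Walsh case `m ≡ 2`:
`‖σ_{2^n+1} f‖_{L_p} ≤ c_p 2^{(1/p-2)n} ‖f‖_{H_p}` for `0 < p < 1/2`. -/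
theorem walsh_fejer_pow_two_add_one_bound
    (μ : Measure (G (fun _ => 2))) (hμ : IsVilenkinMeasure (fun _ => 2) μ)
    (p : ℝ) (hp0 : 0 < p) (hp : p < 1 / 2) :
    ∃ c : ℝ≥0, 0 < c ∧
      ∀ f : ℕ → G (fun _ => 2) → ℂ, IsMartingale (fun _ => 2) μ f →
        hardyNorm (fun _ => 2) p μ f < ⊤ →
        ∀ n : ℕ,
          eLpNorm (sigmaMart (fun _ => 2) μ f (2 ^ n + 1)) (ENNReal.ofReal p) μ ≤
            (c : ℝ≥0∞) * (2 : ℝ≥0∞) ^ ((1 / p - 2) * (n : ℝ)) *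
              hardyNorm (fun _ => 2) p μ f := by
  set C : ℝ≥0∞ := (1 + (1 - (2⁻¹ : ℝ≥0∞) ^ p)⁻¹) ^ (1 / p) with hC
  have hq : (2⁻¹ : ℝ≥0∞) ^ p < 1 := ENNReal.rpow_lt_one (by norm_num) hp0
  have hsub : (1 - (2⁻¹ : ℝ≥0∞) ^ p) ≠ 0 := (tsub_pos_of_lt hq).ne'
  have hCtop : C ≠ ⊤ := ENNReal.rpow_ne_top_of_nonneg (by positivity)
    (ENNReal.add_ne_top.2 ⟨ENNReal.one_ne_top, ENNReal.inv_ne_top.2 hsub⟩)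
  have hCpos : C ≠ 0 := (ENNReal.rpow_pos (lt_of_lt_of_le one_pos le_self_add)
    (ENNReal.add_ne_top.2 ⟨ENNReal.one_ne_top, ENNReal.inv_ne_top.2 hsub⟩)).ne'
  refine ⟨C.toNNReal, ENNReal.toNNReal_pos hCpos hCtop, fun f hf _ n => ?_⟩
  have hgrow : (1 : ℝ≥0∞) ≤ 2 ^ ((1 / p - 2) * (n : ℝ)) := by
    rw [← ENNReal.rpow_zero (x := 2)]
    refine ENNReal.rpow_le_rpow_of_exponent_le one_le_two (mul_nonneg ?_ n.cast_nonneg)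
    rw [sub_nonneg, le_div_iff₀ hp0]
    linarith
  rw [ENNReal.coe_toNNReal hCtop,
    eLpNorm_eq_lintegral_rpow_enorm_toReal (by simpa using hp0) ENNReal.ofReal_ne_top,
    ENNReal.toReal_ofReal hp0.le]
  calc (∫⁻ x, ‖sigmaMart dyadic μ f (2 ^ n + 1) x‖ₑ ^ p ∂μ) ^ (1 / p)
      ≤ ((1 + (1 - (2⁻¹ : ℝ≥0∞) ^ p)⁻¹) * ∫⁻ x, maximalFn dyadic f x ^ p ∂μ) ^ (1 / p) := by
        gcongr
        refine (lintegral_sigmaMart_rpow_le hμ hf hp0 (by linarith) n).trans ?_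
        gcongr with x
        exact le_iSup (fun k => (‖f k x‖₊ : ℝ≥0∞)) n
    _ = C * 1 * hardyNorm dyadic p μ f := by
        rw [ENNReal.mul_rpow_of_nonneg _ _ (by positivity), mul_one, hardyNorm]
    _ ≤ _ := by gcongr

end Vilenkin
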